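/- Let Ω : ℝ → Matrix (Fin n) (Fin n) ℝ satisfy Ω'(t) = −γ ψ(t)ψ(t)ᵀ Ω(t) with Ω(0) = Iₙ, where γ > 0 and ψ is continuous. If ψ is interval exciting, i.e. there exist t_d > 0 and C_d > 0 with ∫₀^{t_d} ψ(s)ψ(s)ᵀ ds ≥ C_d Iₙ as quadratic forms, then there exists δ > 0 such that |det(Iₙ − Ω(t))| ≥ δ for all t ≥ t_d; in particular Iₙ − Ω(t) is invertible for every t ≥ t_d. -/

import Mathlib

open Matrix

/-- Observability Gramian `W(0,T) = ∫₀ᵀ ψ(τ)ψ(τ)ᵀ dτ` (entrywise). -/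
noncomputable def obsGram (n : ℕ) (ψ : ℝ → Fin n → ℝ) (T : ℝ) :
    Matrix (Fin n) (Fin n) ℝ :=
  Matrix.of fun i j => ∫ τ in (0:ℝ)..T, ψ τ i * ψ τ j

/-- The matrices dominated by a strict contraction form a compact set on which
`M ↦ det (1 - M)` does not vanish. -/
theorem exists_pos_le_abs_det_one_sub {n : ℕ} (A : Matrix (Fin n) (Fin n) ℝ)
    (hA : ∀ v : Fin n → ℝ, v ≠ 0 → (A *ᵥ v) ⬝ᵥ (A *ᵥ v) < v ⬝ᵥ v) :
    ∃ δ > (0 : ℝ), ∀ M : Matrix (Fin n) (Fin n) ℝ,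
      (∀ v, (M *ᵥ v) ⬝ᵥ (M *ᵥ v) ≤ (A *ᵥ v) ⬝ᵥ (A *ᵥ v)) → δ ≤ |(1 - M).det| := by
  set K : Set (Matrix (Fin n) (Fin n) ℝ) :=
    {M | ∀ v, (M *ᵥ v) ⬝ᵥ (M *ᵥ v) ≤ (A *ᵥ v) ⬝ᵥ (A *ᵥ v)} with hK
  have hclosed : IsClosed K := by
    rw [hK, Set.ofPred_forall]
    refine isClosed_iInter fun v => isClosed_le ?_ continuous_const
    have hv : Continuous fun M : Matrix (Fin n) (Fin n) ℝ => M *ᵥ v :=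
      continuous_id.matrix_mulVec continuous_const
    exact hv.dotProduct hv
  have hbox : IsCompact (Set.univ.pi fun _ => Set.univ.pi fun _ => Set.Icc (-1) 1 :
      Set (Fin n → Fin n → ℝ)) :=
    isCompact_univ_pi fun _ => isCompact_univ_pi fun _ => isCompact_Icc
  have hcompact : IsCompact K := by
    refine IsCompact.of_isClosed_subset hbox hclosed fun M hM i _ j _ => ?_
    have h1 := (hM (Pi.single j 1)).trans (hA (Pi.single j 1) (by simp)).le
    have h2 : M i j * M i j ≤ (M *ᵥ Pi.single j 1) ⬝ᵥ (M *ᵥ Pi.single j 1) := by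
      simp only [mulVec_single_one, dotProduct]
      exact Finset.single_le_sum (f := fun k => M k j * M k j)
        (fun k _ => mul_self_nonneg _) (Finset.mem_univ i)
    have h3 : M i j ^ 2 ≤ 1 := by
      simp only [single_one_dotProduct, Pi.single_eq_same] at h1
      nlinarith
    exact abs_le.mp ((sq_le_one_iff_abs_le_one _).mp h3)
  have hne : K.Nonempty := ⟨A, fun _ => le_rfl⟩
  have hcont : ContinuousOn (fun M : Matrix (Fin n) (Fin n) ℝ => |(1 - M).det|) K :=
    ((continuous_const.sub continuous_id).matrix_det.abs).continuousOn
  obtain ⟨M₀, hM₀, hmin⟩ := hcompact.exists_isMinOn hne hcont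
  refine ⟨|(1 - M₀).det|, abs_pos.mpr fun hdet => ?_, fun M hM => hmin hM⟩
  obtain ⟨v, hv, hMv⟩ := exists_mulVec_eq_zero_iff.mpr hdet
  have hfix : M₀ *ᵥ v = v := by
    rw [sub_mulVec, one_mulVec, sub_eq_zero] at hMv
    exact hMv.symm
  have hle := hM₀ v
  rw [hfix] at hle
  exact (hA v hv).not_ge hle

theorem hasDerivAt_mulVec_apply {n : ℕ} {Ω : ℝ → Matrix (Fin n) (Fin n) ℝ}
    {Ω' : Matrix (Fin n) (Fin n) ℝ} {t : ℝ}
    (hΩ : ∀ i j, HasDerivAt (fun s => Ω s i j) (Ω' i j) t) (v : Fin n → ℝ) (i : Fin n) :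
    HasDerivAt (fun s => (Ω s *ᵥ v) i) ((Ω' *ᵥ v) i) t := by
  simp only [mulVec, dotProduct]
  exact HasDerivAt.fun_sum fun j _ => (hΩ i j).mul_const (v j)

theorem hasDerivAt_dotProduct_self {n : ℕ} {x : ℝ → Fin n → ℝ} {x' : Fin n → ℝ} {t : ℝ}
    (hx : ∀ i, HasDerivAt (fun s => x s i) (x' i) t) :
    HasDerivAt (fun s => x s ⬝ᵥ x s) (2 * (x t ⬝ᵥ x')) t := by
  simp only [dotProduct, Finset.mul_sum]
  exact HasDerivAt.fun_sum fun i _ => ((hx i).fun_mul (hx i)).congr_deriv (by ring)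

theorem dotProduct_obsGram_mulVec {n : ℕ} {ψ : ℝ → Fin n → ℝ} (hψ : Continuous ψ)
    (T : ℝ) (v : Fin n → ℝ) :
    v ⬝ᵥ (obsGram n ψ T *ᵥ v) = ∫ τ in (0 : ℝ)..T, (ψ τ ⬝ᵥ v) ^ 2 := by
  have hc : ∀ i, Continuous fun τ => ψ τ i := fun i => (continuous_apply i).comp hψ
  have hsq : ∀ τ, (ψ τ ⬝ᵥ v) ^ 2 = ∑ i, ∑ j, v i * (ψ τ i * ψ τ j * v j) := fun τ => by
    rw [sq, dotProduct, Finset.sum_mul_sum]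
    exact Finset.sum_congr rfl fun i _ => Finset.sum_congr rfl fun j _ => by ring
  simp only [hsq]
  rw [intervalIntegral.integral_finsetSum
    fun i _ => Continuous.intervalIntegrable (by fun_prop) _ _]
  simp only [dotProduct, mulVec, obsGram, of_apply, Finset.mul_sum]
  refine Finset.sum_congr rfl fun i _ => ?_
  rw [intervalIntegral.integral_finsetSum
    fun j _ => Continuous.intervalIntegrable (by fun_prop) _ _]
  simp only [intervalIntegral.integral_const_mul, intervalIntegral.integral_mul_const]

section GradientFlow

variable {n : ℕ} {γ : ℝ} {ψ x : ℝ → Fin n → ℝ}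

theorem hasDerivAt_energy
    (hx : ∀ t i, HasDerivAt (fun s => x s i) (-γ * (ψ t ⬝ᵥ x t) * ψ t i) t) (t : ℝ) :
    HasDerivAt (fun s => x s ⬝ᵥ x s) (-(2 * γ) * (ψ t ⬝ᵥ x t) ^ 2) t := by
  convert hasDerivAt_dotProduct_self (x' := (-γ * (ψ t ⬝ᵥ x t)) • ψ t) (hx t) using 1
  rw [dotProduct_smul, dotProduct_comm (x t), smul_eq_mul]
  ring

theorem antitone_energy (hγ : 0 < γ)
    (hx : ∀ t i, HasDerivAt (fun s => x s i) (-γ * (ψ t ⬝ᵥ x t) * ψ t i) t) :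
    Antitone fun t => x t ⬝ᵥ x t := by
  refine antitone_of_hasDerivAt_nonpos (hasDerivAt_energy hx) fun t => ?_
  exact mul_nonpos_of_nonpos_of_nonneg (by linarith) (sq_nonneg _)

/-- If the energy does not decrease on `[0, T]`, the trajectory is constant there and
orthogonal to `ψ`. -/
theorem dotProduct_initial_eq_zero_of_energy_le (hγ : 0 < γ)
    (hx : ∀ t i, HasDerivAt (fun s => x s i) (-γ * (ψ t ⬝ᵥ x t) * ψ t i) t)
    {T : ℝ} (hT : x 0 ⬝ᵥ x 0 ≤ x T ⬝ᵥ x T) :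
    ∀ t ∈ Set.Ico 0 T, ψ t ⬝ᵥ x 0 = 0 := by
  have hanti := antitone_energy hγ hx
  have horth : ∀ t ∈ Set.Ico 0 T, ψ t ⬝ᵥ x t = 0 := by
    intro t ht
    have hconst : ∀ s ∈ Set.Icc t T, x s ⬝ᵥ x s = x 0 ⬝ᵥ x 0 := fun s hs =>
      le_antisymm (hanti (ht.1.trans hs.1)) (hT.trans (hanti hs.2))
    have hmem : t ∈ Set.Icc t T := Set.left_mem_Icc.mpr ht.2.le
    have h0 : HasDerivWithinAt (fun s => x s ⬝ᵥ x s) 0 (Set.Icc t T) t :=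
      (hasDerivWithinAt_const t _ (x 0 ⬝ᵥ x 0)).congr hconst (hconst t hmem)
    have h := (uniqueDiffOn_Icc ht.2 t hmem).eq_deriv _
      (hasDerivAt_energy hx t).hasDerivWithinAt h0
    simpa [hγ.ne'] using h
  intro t ht
  have hxt : x t = x 0 := funext fun i =>
    constant_of_has_deriv_right_zero (f := fun s => x s i)
      (fun s _ => (hx s i).continuousAt.continuousWithinAt)
      (fun s hs => by simpa [horth s hs] using (hx s i).hasDerivWithinAt (s := Set.Ici s))
      t (Set.Ico_subset_Icc_self ht)
  rw [← hxt]
  exact horth t ht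

end GradientFlow

/-- If `ψ` is interval exciting, then `|det(Iₙ − Ω(t))|` is bounded away from zero
for `t ≥ t_d`; in particular `Iₙ − Ω(t)` is invertible for `t ≥ t_d`. -/
theorem det_bounded_below_of_interval_excitation (n : ℕ) (hn : 1 ≤ n)
    (γ : ℝ) (hγ : 0 < γ)
    (ψ : ℝ → Fin n → ℝ) (hψ : Continuous ψ)
    (Ω : ℝ → Matrix (Fin n) (Fin n) ℝ)
    (hΩ : ∀ t, ∀ i j, HasDerivAt (fun s => Ω s i j)
        ((((-γ) • vecMulVec (ψ t) (ψ t)) * Ω t) i j) t)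
    (hΩ0 : Ω 0 = 1)
    (td Cd : ℝ) (htd : 0 < td) (hCd : 0 < Cd)
    (hIE : ∀ v : Fin n → ℝ, Cd * (v ⬝ᵥ v) ≤ v ⬝ᵥ (obsGram n ψ td *ᵥ v)) :
    ∃ δ > (0:ℝ), ∀ t ≥ td,
      δ ≤ |((1 : Matrix (Fin n) (Fin n) ℝ) - Ω t).det| ∧
      IsUnit ((1 : Matrix (Fin n) (Fin n) ℝ) - Ω t) := by
  have hx : ∀ v t i, HasDerivAt (fun s => (Ω s *ᵥ v) i)
      (-γ * (ψ t ⬝ᵥ (Ω t *ᵥ v)) * ψ t i) t := fun v t i => by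
    convert hasDerivAt_mulVec_apply (hΩ t) v i using 1
    rw [← mulVec_mulVec, smul_mulVec, vecMulVec_mulVec]
    simp only [Pi.smul_apply, smul_eq_mul, MulOpposite.smul_eq_mul_unop, MulOpposite.unop_op]
    ring
  obtain ⟨δ, hδ, hdet⟩ := exists_pos_le_abs_det_one_sub (Ω td) fun v hv => by
    by_contra! hle
    have horth : ∀ t ∈ Set.Ico 0 td, ψ t ⬝ᵥ v = 0 := by
      simpa [hΩ0] using dotProduct_initial_eq_zero_of_energy_le hγ (hx v)
        (T := td) (by simpa [hΩ0] using hle)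
    have hzero : ∫ τ in (0 : ℝ)..td, (ψ τ ⬝ᵥ v) ^ 2 = 0 := by
      rw [intervalIntegral.integral_of_le htd.le, MeasureTheory.integral_Ioc_eq_integral_Ioo]
      exact MeasureTheory.setIntegral_eq_zero_of_forall_eq_zero fun τ hτ => by
        simp [horth τ (Set.Ioo_subset_Ico_self hτ)]
    have hW := hIE v
    rw [dotProduct_obsGram_mulVec hψ, hzero] at hW
    have hpos : 0 < v ⬝ᵥ v := by simpa using dotProduct_star_self_pos_iff.mpr hv
    exact (mul_pos hCd hpos).not_ge hW
  refine ⟨δ, hδ, fun t ht => ?_⟩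
  have hle := hdet (Ω t) fun v => antitone_energy hγ (hx v) ht
  refine ⟨hle, (isUnit_iff_isUnit_det _).mpr (isUnit_iff_ne_zero.mpr ?_)⟩
  exact abs_pos.mp (hδ.trans_le hle)
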